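/- There exists a function ε : ℕ → ℝ with ε(n) → 0 as n → ∞ such that the following holds. For every n, put d = 2^n and N = d(d+1), let M be a complete MUB ensemble in ℂ^d, and let S = (ψ_1,…,ψ_N) be any list of N unit vectors in ℂ^d (repetitions allowed). Then W(S) ≤ W(M) + (√(log d)/d)·(1 + ε(n)). In particular, sup over all N-point lists S of (W(S) − W(M)) tends to 0 as n → ∞. -/

import Mathlib

open MeasureTheory ProbabilityTheory Matrix

noncomputable section

/-- The centered projection `Q_ψ = |ψ⟩⟨ψ| − I/d` associated to a vector `ψ ∈ ℂ^d`. -/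
def Qmat {d : ℕ} (ψ : Fin d → ℂ) : Matrix (Fin d) (Fin d) ℂ :=
  Matrix.vecMulVec ψ (star ψ) - (d : ℂ)⁻¹ • (1 : Matrix (Fin d) (Fin d) ℂ)

/-- `B` is an orthonormal basis of `ℂ^d` (as a `d`-tuple of vectors). -/
def IsONB {d : ℕ} (B : Fin d → Fin d → ℂ) : Prop :=
  ∀ i j, star (B i) ⬝ᵥ B j = if i = j then (1 : ℂ) else 0

/-- `B` is a complete system of `d+1` mutually unbiased bases of `ℂ^d`. -/
def IsCompleteMUB {d : ℕ} (B : Fin (d + 1) → Fin d → Fin d → ℂ) : Prop :=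
  (∀ a, IsONB (B a)) ∧
    ∀ a b i j, a ≠ b → Complex.normSq (star (B a i) ⬝ᵥ B b j) = 1 / d

/-- `H` is a standard isotropic Gaussian Hamiltonian on `ℂ^d` under the probability
measure `μ`: it is `∑ k, g k • E k` for an orthonormal basis `E` of the real space of
traceless Hermitian `d×d` matrices (Hilbert–Schmidt inner product) and i.i.d. standard
real Gaussians `g k`. -/
def IsStdGaussianHamiltonian {d : ℕ} {Ω : Type*} [MeasurableSpace Ω]
    (μ : Measure Ω) (H : Ω → Matrix (Fin d) (Fin d) ℂ) : Prop :=
  ∃ (E : Fin (d ^ 2 - 1) → Matrix (Fin d) (Fin d) ℂ)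
    (g : Fin (d ^ 2 - 1) → Ω → ℝ),
      (∀ k, (E k).IsHermitian) ∧
      (∀ k, (E k).trace = 0) ∧
      (∀ k l, (E k * E l).trace = if k = l then (1 : ℂ) else 0) ∧
      Measurable (fun ω k => g k ω) ∧
      Measure.map (fun ω k => g k ω) μ =
        Measure.pi (fun _ : Fin (d ^ 2 - 1) => gaussianReal 0 1) ∧
      ∀ ω, H ω = ∑ k, (g k ω : ℂ) • E k

/-- The standard Gaussian measure on `κ → ℝ`. -/
abbrev stdGaussianPi (κ : Type*) [Fintype κ] : Measure (κ → ℝ) :=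
  Measure.pi fun _ => gaussianReal 0 1

section Stein

theorem hasDerivAt_gaussianPDFReal_std (t : ℝ) :
    HasDerivAt (gaussianPDFReal 0 1) (-(t * gaussianPDFReal 0 1 t)) t := by
  have h : HasDerivAt (fun x : ℝ => (√(2 * Real.pi * 1))⁻¹ * Real.exp (-(x - 0) ^ 2 / (2 * 1)))
      ((√(2 * Real.pi * 1))⁻¹ * (Real.exp (-(t - 0) ^ 2 / (2 * 1)) *
        (-((2 : ℕ) * (t - 0) ^ (2 - 1) * 1) / (2 * 1)))) t :=
    (((((hasDerivAt_id t).sub_const 0).pow 2).neg.div_const _).exp).const_mul _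
  have e (x : ℝ) : gaussianPDFReal 0 1 x =
      (√(2 * Real.pi * 1))⁻¹ * Real.exp (-(x - 0) ^ 2 / (2 * 1)) := by simp [gaussianPDFReal]
  rw [funext e]
  convert h using 1
  push_cast
  ring

theorem integrable_id_gaussianReal_std : Integrable (fun t : ℝ => t) (gaussianReal 0 1) :=
  (memLp_id_gaussianReal 1).integrable (by simp)

theorem integrable_bdd_gaussianReal_std {f : ℝ → ℝ} {C : ℝ} (hf : Continuous f)
    (hC : ∀ t, |f t| ≤ C) : Integrable f (gaussianReal 0 1) :=
  Integrable.of_bound hf.aestronglyMeasurable C (ae_of_all _ hC)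

theorem integrable_gaussianReal_std_iff {f : ℝ → ℝ} :
    Integrable f (gaussianReal 0 1) ↔ Integrable (fun t => gaussianPDFReal 0 1 t * f t) := by
  rw [gaussianReal_of_var_ne_zero _ one_ne_zero,
    integrable_withDensity_iff_integrable_smul' (measurable_gaussianPDF 0 1)
      (ae_of_all _ fun _ => gaussianPDF_lt_top)]
  simp [toReal_gaussianPDF]

/-- One-dimensional Gaussian integration by parts. -/
theorem integral_id_mul_gaussianReal_std {f f' : ℝ → ℝ} {C C' : ℝ}
    (hderiv : ∀ t, HasDerivAt f (f' t) t) (hf' : Continuous f')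
    (hC : ∀ t, |f t| ≤ C) (hC' : ∀ t, |f' t| ≤ C') :
    ∫ t, t * f t ∂gaussianReal 0 1 = ∫ t, f' t ∂gaussianReal 0 1 := by
  have hf : Continuous f := continuous_iff_continuousAt.2 fun t => (hderiv t).continuousAt
  have h1 := integrable_gaussianReal_std_iff.1
    (integrable_id_gaussianReal_std.mul_bdd hf.aestronglyMeasurable (ae_of_all _ hC))
  have h2 := integrable_gaussianReal_std_iff.1 (integrable_bdd_gaussianReal_std hf' hC')
  have h3 := integrable_gaussianReal_std_iff.1 (integrable_bdd_gaussianReal_std hf hC)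
  have key := integral_mul_deriv_eq_deriv_mul_of_integrable
    (u := f) (u' := f') (v := gaussianPDFReal 0 1) (v' := fun t => -(t * gaussianPDFReal 0 1 t))
    (fun t _ => hderiv t) (fun t _ => hasDerivAt_gaussianPDFReal_std t)
    (h1.neg.congr (ae_of_all _ fun t => by simp; ring))
    (h2.congr (ae_of_all _ fun t => by simp; ring))
    (h3.congr (ae_of_all _ fun t => by simp; ring))
  simp only [integral_gaussianReal_eq_integral_smul one_ne_zero, smul_eq_mul]
  rw [← neg_inj] at key
  simp only [mul_neg, integral_neg, neg_neg] at key
  calc _ = ∫ t, f t * (t * gaussianPDFReal 0 1 t) := by congr with t; ring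
    _ = _ := by rw [key]; congr with t; ring

variable {κ : Type*} [Fintype κ]

/-- Resampling one coordinate preserves a product of probability measures. -/
theorem measurePreserving_update_pi [DecidableEq κ] {X : κ → Type*} [∀ i, MeasurableSpace (X i)]
    (ν : ∀ i, Measure (X i)) [∀ i, IsProbabilityMeasure (ν i)] (k : κ) :
    MeasurePreserving (fun p : (∀ i, X i) × X k => Function.update p.1 k p.2)
      ((Measure.pi ν).prod (ν k)) (Measure.pi ν) := by
  have hm : Measurable (fun p : (∀ i, X i) × X k => Function.update p.1 k p.2) := by
    refine measurable_pi_iff.2 fun i => ?_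
    by_cases h : i = k
    · subst h
      simpa using measurable_snd
    · simp only [Function.update_of_ne h]
      exact (measurable_pi_apply i).comp measurable_fst
  refine ⟨hm, (Measure.pi_eq fun s hs => ?_).symm⟩
  rw [Measure.map_apply hm (MeasurableSet.univ_pi hs)]
  have : (fun p : (∀ i, X i) × X k => Function.update p.1 k p.2) ⁻¹' Set.pi Set.univ s =
      (Set.pi Set.univ (Function.update s k Set.univ)) ×ˢ s k := by
    ext ⟨x, t⟩
    simp only [Set.mem_preimage, Set.mem_pi, Set.mem_univ, true_imp_iff, Set.mem_prod]
    constructor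
    · intro h
      refine ⟨fun i => ?_, by simpa using h k⟩
      by_cases hi : i = k
      · subst hi; simp
      · simpa [hi] using h i
    · rintro ⟨h, ht⟩ i
      by_cases hi : i = k
      · subst hi; simpa using ht
      · simpa [hi] using h i
  rw [this, Measure.prod_prod, Measure.pi_pi, ← Finset.mul_prod_erase _ _ (Finset.mem_univ k),
    ← Finset.mul_prod_erase Finset.univ (fun i => ν i (s i)) (Finset.mem_univ k)]
  simp only [Function.update_self, measure_univ, one_mul]
  rw [mul_comm]
  congr 1
  refine Finset.prod_congr rfl fun i hi => ?_
  rw [Function.update_of_ne (Finset.ne_of_mem_erase hi)]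

theorem integrable_eval_stdGaussianPi (k : κ) :
    Integrable (fun x : κ → ℝ => x k) (stdGaussianPi κ) :=
  (measurePreserving_eval (fun _ : κ => gaussianReal 0 1) k).integrable_comp_of_integrable
    integrable_id_gaussianReal_std

theorem integrable_bdd_stdGaussianPi {f : (κ → ℝ) → ℝ} {C : ℝ} (hf : Continuous f)
    (hC : ∀ x, |f x| ≤ C) : Integrable f (stdGaussianPi κ) :=
  Integrable.of_bound hf.aestronglyMeasurable C (ae_of_all _ hC)

theorem integrable_eval_mul_stdGaussianPi (k : κ) {f : (κ → ℝ) → ℝ} {C : ℝ} (hf : Continuous f)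
    (hC : ∀ x, |f x| ≤ C) : Integrable (fun x => x k * f x) (stdGaussianPi κ) :=
  (integrable_eval_stdGaussianPi k).mul_bdd hf.aestronglyMeasurable (ae_of_all _ hC)

/-- Gaussian integration by parts in one coordinate of a standard Gaussian vector. -/
theorem integral_eval_mul_stdGaussianPi [DecidableEq κ] (k : κ) {f f' : (κ → ℝ) → ℝ} {C C' : ℝ}
    (hderiv : ∀ x, ∀ t, HasDerivAt (fun t => f (Function.update x k t))
      (f' (Function.update x k t)) t)
    (hf : Continuous f) (hf' : Continuous f')
    (hC : ∀ x, |f x| ≤ C) (hC' : ∀ x, |f' x| ≤ C') :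
    ∫ x, x k * f x ∂stdGaussianPi κ = ∫ x, f' x ∂stdGaussianPi κ := by
  have hmp : MeasurePreserving (fun p : (κ → ℝ) × ℝ => Function.update p.1 k p.2)
      ((stdGaussianPi κ).prod (gaussianReal 0 1)) (stdGaussianPi κ) :=
    measurePreserving_update_pi (fun _ : κ => gaussianReal 0 1) k
  have hint1 := integrable_eval_mul_stdGaussianPi k hf hC
  have hint2 := integrable_bdd_stdGaussianPi hf' hC'
  rw [← hmp.map_eq] at hint1 hint2
  have e1 := integral_map hmp.aemeasurable hint1.aestronglyMeasurable
  have e2 := integral_map hmp.aemeasurable hint2.aestronglyMeasurable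
  rw [hmp.map_eq] at e1 e2
  have i1 := hint1.comp_measurable hmp.measurable
  have i2 := hint2.comp_measurable hmp.measurable
  simp only [Function.comp_def] at i1 i2
  rw [e1, e2, integral_prod _ i1, integral_prod _ i2]
  refine integral_congr_ae (ae_of_all _ fun x => ?_)
  simp only [Function.update_self]
  exact integral_id_mul_gaussianReal_std (hderiv x)
    (hf'.comp (continuous_const.update k continuous_id)) (fun t => hC _) (fun t => hC' _)

end Stein

section Softmax

variable {ι : Type*} [Fintype ι]

/-- The log-sum-exp function. -/
def logSumExp (y : ι → ℝ) : ℝ := Real.log (∑ i, Real.exp (y i))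

/-- The softmax weights, i.e. the gradient of `logSumExp`. -/
def softmax (y : ι → ℝ) (i : ι) : ℝ := Real.exp (y i) / ∑ j, Real.exp (y j)

variable [Nonempty ι]

theorem sum_exp_pos (y : ι → ℝ) : 0 < ∑ i, Real.exp (y i) :=
  Finset.sum_pos (fun _ _ => Real.exp_pos _) Finset.univ_nonempty

theorem softmax_nonneg (y : ι → ℝ) (i : ι) : 0 ≤ softmax y i :=
  div_nonneg (Real.exp_pos _).le (sum_exp_pos y).le

theorem sum_softmax (y : ι → ℝ) : ∑ i, softmax y i = 1 := by
  simp only [softmax, ← Finset.sum_div]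
  exact div_self (sum_exp_pos y).ne'

theorem softmax_le_one (y : ι → ℝ) (i : ι) : softmax y i ≤ 1 := by
  rw [← sum_softmax y]
  exact Finset.single_le_sum (fun j _ => softmax_nonneg y j) (Finset.mem_univ i)

theorem abs_softmax_le_one (y : ι → ℝ) (i : ι) : |softmax y i| ≤ 1 := by
  rw [abs_of_nonneg (softmax_nonneg y i)]
  exact softmax_le_one y i

theorem abs_sum_softmax_mul_le (y v : ι → ℝ) : |∑ i, softmax y i * v i| ≤ ∑ i, |v i| := by
  refine (Finset.abs_sum_le_sum_abs _ _).trans (Finset.sum_le_sum fun i _ => ?_)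
  rw [abs_mul]
  exact mul_le_of_le_one_left (abs_nonneg _) (abs_softmax_le_one y i)

theorem continuous_softmax (i : ι) : Continuous fun y : ι → ℝ => softmax y i :=
  Continuous.div (by fun_prop) (by fun_prop) fun y => (sum_exp_pos y).ne'

theorem continuous_logSumExp : Continuous (logSumExp : (ι → ℝ) → ℝ) :=
  Continuous.log (by fun_prop) fun y => (sum_exp_pos y).ne'

theorem HasDerivAt.logSumExp {y : ℝ → ι → ℝ} {y' : ι → ℝ} {t : ℝ}
    (h : ∀ i, HasDerivAt (fun t => y t i) (y' i) t) :
    HasDerivAt (fun t => logSumExp (y t)) (∑ i, softmax (y t) i * y' i) t := by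
  have := (HasDerivAt.fun_sum fun i (_ : i ∈ Finset.univ) => (h i).exp).log (sum_exp_pos (y t)).ne'
  refine HasDerivAt.congr_deriv this ?_
  rw [Finset.sum_div]
  exact Finset.sum_congr rfl fun i _ => by rw [softmax]; ring

theorem HasDerivAt.softmax {y : ℝ → ι → ℝ} {y' : ι → ℝ} {t : ℝ}
    (h : ∀ i, HasDerivAt (fun t => y t i) (y' i) t) (i : ι) :
    HasDerivAt (fun t => softmax (y t) i)
      (softmax (y t) i * (y' i - ∑ j, softmax (y t) j * y' j)) t := by
  have hp := (sum_exp_pos (y t)).ne'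
  have := (h i).exp.div (HasDerivAt.fun_sum fun i (_ : i ∈ Finset.univ) => (h i).exp) hp
  refine HasDerivAt.congr_deriv this ?_
  have e : ∑ j, _root_.softmax (y t) j * y' j =
      (∑ j, Real.exp (y t j) * y' j) / ∑ j, Real.exp (y t j) := by
    rw [Finset.sum_div]
    exact Finset.sum_congr rfl fun i _ => by rw [_root_.softmax]; ring
  rw [e, _root_.softmax]
  field_simp

theorem le_logSumExp (y : ι → ℝ) (i : ι) : y i ≤ logSumExp y := by
  rw [logSumExp, Real.le_log_iff_exp_le (sum_exp_pos y)]
  exact Finset.single_le_sum (f := fun i => Real.exp (y i)) (fun j _ => (Real.exp_pos _).le)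
    (Finset.mem_univ i)

theorem logSumExp_le {y : ι → ℝ} {c : ℝ} (h : ∀ i, y i ≤ c) :
    logSumExp y ≤ c + Real.log (Fintype.card ι) := by
  rw [logSumExp, Real.log_le_iff_le_exp (sum_exp_pos y), Real.exp_add,
    Real.exp_log (by exact_mod_cast Fintype.card_pos)]
  refine (Finset.sum_le_card_nsmul _ _ (Real.exp c) fun i _ => Real.exp_le_exp.2 (h i)).trans ?_
  simp [mul_comm]

/-- For weights summing to one, the variance-type quadratic form of a symmetric matrix is
controlled by its increments. -/
theorem softmax_quadratic_nonneg (y : ι → ℝ) {V : ι → ι → ℝ}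
    (hV : ∀ i j, 0 ≤ V i i + V j j - V i j - V j i) :
    0 ≤ ∑ i, softmax y i * (V i i - ∑ j, softmax y j * V i j) := by
  have key : 2 * ∑ i, softmax y i * (V i i - ∑ j, softmax y j * V i j) =
      ∑ i, ∑ j, softmax y i * softmax y j * (V i i + V j j - V i j - V j i) := by
    have e1 : ∑ i, ∑ j, softmax y i * softmax y j * V i i = ∑ i, softmax y i * V i i := by
      refine Finset.sum_congr rfl fun i _ => ?_
      rw [← Finset.sum_mul, ← Finset.mul_sum, sum_softmax, mul_one]
    have e2 : ∑ i, ∑ j, softmax y i * softmax y j * V j j = ∑ i, softmax y i * V i i := by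
      rw [Finset.sum_comm, ← e1]
      exact Finset.sum_congr rfl fun i _ => Finset.sum_congr rfl fun j _ => by ring
    have e3 : ∑ i, ∑ j, softmax y i * softmax y j * V j i =
        ∑ i, ∑ j, softmax y i * softmax y j * V i j := by
      rw [Finset.sum_comm]
      exact Finset.sum_congr rfl fun i _ => Finset.sum_congr rfl fun j _ => by ring
    have e4 : ∑ i, softmax y i * ∑ j, softmax y j * V i j =
        ∑ i, ∑ j, softmax y i * softmax y j * V i j := by
      simp only [Finset.mul_sum, mul_assoc]
    simp only [mul_sub, mul_add, Finset.sum_sub_distrib, Finset.sum_add_distrib, e1, e2, e3, e4]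
    ring
  have : 0 ≤ 2 * ∑ i, softmax y i * (V i i - ∑ j, softmax y j * V i j) := by
    rw [key]
    exact Finset.sum_nonneg fun i _ => Finset.sum_nonneg fun j _ =>
      mul_nonneg (mul_nonneg (softmax_nonneg y i) (softmax_nonneg y j)) (hV i j)
  linarith

end Softmax

section Interpolation

variable {ι κ : Type*} [Fintype κ]

theorem integrable_mulVec_stdGaussianPi (A : Matrix ι κ ℝ) (i : ι) :
    Integrable (fun x => (A *ᵥ x) i) (stdGaussianPi κ) := by
  simp only [Matrix.mulVec, dotProduct]
  exact integrable_finsetSum _ fun k _ => (integrable_eval_stdGaussianPi k).const_mul _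

theorem continuous_mulVec_apply (A : Matrix ι κ ℝ) : Continuous fun x : κ → ℝ => A *ᵥ x := by
  fun_prop

variable [Fintype ι] [Nonempty ι]

theorem abs_logSumExp_le (y : ι → ℝ) :
    |logSumExp y| ≤ (∑ i, |y i|) + Real.log (Fintype.card ι) := by
  have h0 : 0 ≤ Real.log (Fintype.card ι) := Real.log_natCast_nonneg _
  have hs (i : ι) : |y i| ≤ ∑ i, |y i| :=
    Finset.single_le_sum (f := fun i => |y i|) (fun _ _ => abs_nonneg _) (Finset.mem_univ i)
  obtain ⟨i⟩ := ‹Nonempty ι›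
  refine abs_le.2 ⟨?_, logSumExp_le fun i => (le_abs_self _).trans (hs i)⟩
  have := le_logSumExp y i
  linarith [hs i, neg_abs_le (y i)]

theorem integrable_logSumExp_mulVec (A : Matrix ι κ ℝ) :
    Integrable (fun x => logSumExp (A *ᵥ x)) (stdGaussianPi κ) := by
  refine Integrable.mono' (g := fun x => (∑ i, |(A *ᵥ x) i|) + Real.log (Fintype.card ι)) ?_
    (continuous_logSumExp.comp (continuous_mulVec_apply A)).aestronglyMeasurable
    (ae_of_all _ fun x => abs_logSumExp_le _)
  exact (integrable_finsetSum _ fun i _ => (integrable_mulVec_stdGaussianPi A i).abs).add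
    (integrable_const _)

/-- Gaussian integration by parts for a softmax weight of a linear image. -/
theorem integral_softmax_mulVec_mul (C C' : Matrix ι κ ℝ) (i : ι) :
    ∫ x, softmax (C *ᵥ x) i * (C' *ᵥ x) i ∂stdGaussianPi κ =
      ∫ x, softmax (C *ᵥ x) i * ((C' * Cᵀ) i i - ∑ j, softmax (C *ᵥ x) j * (C' * Cᵀ) i j)
        ∂stdGaussianPi κ := by
  classical
  have hcs (j : ι) : Continuous fun x : κ → ℝ => softmax (C *ᵥ x) j :=
    (continuous_softmax j).comp (continuous_mulVec_apply C)
  have hcg (k : κ) : Continuous fun x : κ → ℝ =>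
      softmax (C *ᵥ x) i * (C i k - ∑ j, softmax (C *ᵥ x) j * C j k) := by fun_prop
  have hbg (k : κ) (x : κ → ℝ) :
      |softmax (C *ᵥ x) i * (C i k - ∑ j, softmax (C *ᵥ x) j * C j k)| ≤
        |C i k| + ∑ j, |C j k| := by
    rw [abs_mul]
    refine (mul_le_of_le_one_left (abs_nonneg _) (abs_softmax_le_one _ i)).trans ?_
    exact (abs_sub _ _).trans (add_le_add_right (abs_sum_softmax_mul_le _ _) _)
  have stein (k : κ) : ∫ x, x k * softmax (C *ᵥ x) i ∂stdGaussianPi κ =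
      ∫ x, softmax (C *ᵥ x) i * (C i k - ∑ j, softmax (C *ᵥ x) j * C j k) ∂stdGaussianPi κ := by
    refine integral_eval_mul_stdGaussianPi k (fun x t => ?_) (hcs i) (hcg k)
      (fun x => abs_softmax_le_one _ i) (hbg k)
    refine HasDerivAt.softmax (y := fun t => C *ᵥ Function.update x k t)
      (y' := fun j => C j k) (fun j => ?_) i
    have := HasDerivAt.fun_sum (u := Finset.univ) (A := fun l t => C j l * Function.update x k t l)
      (A' := fun l => C j l * (Pi.single k (1 : ℝ) : κ → ℝ) l) (x := t)
      fun l _ => (hasDerivAt_pi.1 (hasDerivAt_update x k t) l).const_mul _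
    simpa [Matrix.mulVec, dotProduct, Pi.single_apply] using this
  calc _ = ∑ k, C' i k * ∫ x, x k * softmax (C *ᵥ x) i ∂stdGaussianPi κ := by
        simp only [← integral_const_mul]
        rw [← integral_finsetSum _ fun k _ => (integrable_eval_mul_stdGaussianPi k (hcs i)
          (fun x => abs_softmax_le_one _ i)).const_mul _]
        congr with x
        simp only [Matrix.mulVec, dotProduct, Finset.mul_sum]
        exact Finset.sum_congr rfl fun k _ => by ring
    _ = _ := by
        simp only [stein, ← integral_const_mul]
        rw [← integral_finsetSum _ fun k _ =>
          (integrable_bdd_stdGaussianPi (hcg k) (hbg k)).const_mul _]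
        congr with x
        simp only [Matrix.mul_apply, Matrix.transpose_apply, Finset.mul_sum, mul_sub,
          Finset.sum_sub_distrib]
        congr 1
        · exact Finset.sum_congr rfl fun k _ => by ring
        · rw [Finset.sum_comm]
          exact Finset.sum_congr rfl fun k _ => Finset.sum_congr rfl fun j _ => by ring

/-- The Sudakov-Fernique inequality for `logSumExp`, for two uncorrelated Gaussian vectors. -/
theorem integral_logSumExp_le_of_orthogonal (A B : Matrix ι κ ℝ) (hAB : A * Bᵀ = 0)
    (hinc : ∀ i j, ∑ k, (A i k - A j k) ^ 2 ≤ ∑ k, (B i k - B j k) ^ 2) :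
    ∫ x, logSumExp (A *ᵥ x) ∂stdGaussianPi κ ≤ ∫ x, logSumExp (B *ᵥ x) ∂stdGaussianPi κ := by
  set C : ℝ → Matrix ι κ ℝ := fun θ => Real.cos θ • A + Real.sin θ • B with hC
  set C' : ℝ → Matrix ι κ ℝ := fun θ => -Real.sin θ • A + Real.cos θ • B with hC'
  have hBA : B * Aᵀ = 0 := by
    have := congrArg Matrix.transpose hAB
    simpa using this
  have hV (θ : ℝ) : C' θ * (C θ)ᵀ = (Real.sin θ * Real.cos θ) • (B * Bᵀ - A * Aᵀ) := by
    simp only [hC, hC', Matrix.transpose_add, Matrix.transpose_smul, Matrix.add_mul,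
      Matrix.mul_add, Matrix.smul_mul, Matrix.mul_smul, hAB, hBA]
    module
  have hderiv (θ : ℝ) : HasDerivAt (fun θ => ∫ x, logSumExp (C θ *ᵥ x) ∂stdGaussianPi κ)
      (∫ x, ∑ i, softmax (C θ *ᵥ x) i * (C' θ *ᵥ x) i ∂stdGaussianPi κ) θ := by
    refine (hasDerivAt_integral_of_dominated_loc_of_deriv_le (s := Set.univ)
      (F := fun θ x => logSumExp (C θ *ᵥ x))
      (F' := fun θ x => ∑ i, softmax (C θ *ᵥ x) i * (C' θ *ᵥ x) i)
      (bound := fun x => ∑ i, (|(A *ᵥ x) i| + |(B *ᵥ x) i|))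
      Filter.univ_mem (Filter.Eventually.of_forall fun θ =>
        (integrable_logSumExp_mulVec (C θ)).aestronglyMeasurable)
      (integrable_logSumExp_mulVec (C θ)) ?_ (ae_of_all _ fun x θ _ => ?_) ?_
      (ae_of_all _ fun x θ _ => ?_)).2
    · refine Continuous.aestronglyMeasurable (continuous_finsetSum _ fun i _ => ?_)
      exact ((continuous_softmax i).comp (continuous_mulVec_apply _)).mul
        ((continuous_apply i).comp (continuous_mulVec_apply _))
    · refine (abs_sum_softmax_mul_le _ _).trans (Finset.sum_le_sum fun i _ => ?_)
      simp only [hC', Matrix.add_mulVec, Matrix.smul_mulVec, Pi.add_apply, Pi.smul_apply,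
        smul_eq_mul]
      refine (abs_add_le _ _).trans (add_le_add ?_ ?_) <;> rw [abs_mul]
      · rw [abs_neg]
        exact mul_le_of_le_one_left (abs_nonneg _) (Real.abs_sin_le_one θ)
      · exact mul_le_of_le_one_left (abs_nonneg _) (Real.abs_cos_le_one θ)
    · exact integrable_finsetSum _ fun i _ => (integrable_mulVec_stdGaussianPi A i).abs.add
        (integrable_mulVec_stdGaussianPi B i).abs
    · refine HasDerivAt.logSumExp fun i => ?_
      simp only [hC, hC', Matrix.add_mulVec, Matrix.smul_mulVec, Pi.add_apply, Pi.smul_apply,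
        smul_eq_mul]
      exact ((Real.hasDerivAt_cos θ).mul_const _).add ((Real.hasDerivAt_sin θ).mul_const _)
  have hnonneg (θ : ℝ) (hs : 0 ≤ Real.sin θ) (hc : 0 ≤ Real.cos θ) :
      0 ≤ ∫ x, ∑ i, softmax (C θ *ᵥ x) i * (C' θ *ᵥ x) i ∂stdGaussianPi κ := by
    have hcs (j : ι) : Continuous fun x : κ → ℝ => softmax (C θ *ᵥ x) j :=
      (continuous_softmax j).comp (continuous_mulVec_apply _)
    rw [integral_finsetSum _ fun i _ => by
      simpa only [mul_comm] using (integrable_mulVec_stdGaussianPi (C' θ) i).mul_bdd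
        (hcs i).aestronglyMeasurable (ae_of_all _ fun x => abs_softmax_le_one _ i)]
    simp only [integral_softmax_mulVec_mul]
    rw [← integral_finsetSum]
    · refine integral_nonneg fun x => softmax_quadratic_nonneg _ fun i j => ?_
      rw [hV]
      simp only [Matrix.smul_apply, Matrix.sub_apply, Matrix.mul_apply,
        Matrix.transpose_apply, smul_eq_mul]
      have h := hinc i j
      simp only [sub_sq, Finset.sum_add_distrib, Finset.sum_sub_distrib, mul_assoc,
        ← Finset.mul_sum] at h
      simp only [pow_two] at h
      have e (M : Matrix ι κ ℝ) : ∑ k, M j k * M i k = ∑ k, M i k * M j k :=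
        Finset.sum_congr rfl fun k _ => mul_comm _ _
      rw [e A, e B]
      have := mul_nonneg (mul_nonneg hs hc) (sub_nonneg.2 h)
      linarith
    · intro i _
      refine integrable_bdd_stdGaussianPi (C := |(C' θ * (C θ)ᵀ) i i| +
        ∑ j, |(C' θ * (C θ)ᵀ) i j|) (by fun_prop) fun x => ?_
      rw [abs_mul]
      refine (mul_le_of_le_one_left (abs_nonneg _) (abs_softmax_le_one _ i)).trans ?_
      exact (abs_sub _ _).trans (add_le_add_right (abs_sum_softmax_mul_le _ _) _)
  have hmono : MonotoneOn (fun θ => ∫ x, logSumExp (C θ *ᵥ x) ∂stdGaussianPi κ)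
      (Set.Icc 0 (Real.pi / 2)) := by
    refine monotoneOn_of_deriv_nonneg (convex_Icc _ _)
      (fun θ _ => (hderiv θ).continuousAt.continuousWithinAt)
      (fun θ _ => (hderiv θ).differentiableAt.differentiableWithinAt) fun θ hθ => ?_
    rw [interior_Icc] at hθ
    rw [(hderiv θ).deriv]
    exact hnonneg θ (Real.sin_nonneg_of_nonneg_of_le_pi hθ.1.le (by linarith [hθ.2, Real.pi_pos]))
      (Real.cos_nonneg_of_neg_pi_div_two_le_of_le (by linarith [hθ.1, Real.pi_pos]) hθ.2.le)
  have := hmono (Set.left_mem_Icc.2 Real.pi_div_two_pos.le)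
    (Set.right_mem_Icc.2 Real.pi_div_two_pos.le) Real.pi_div_two_pos.le
  simpa [hC] using this

end Interpolation

section Comparison

variable {ι κ κ' : Type*} [Fintype κ] [Fintype κ']

theorem measurePreserving_comp_inl_stdGaussianPi :
    MeasurePreserving (fun x : κ ⊕ κ' → ℝ => x ∘ Sum.inl)
      (stdGaussianPi (κ ⊕ κ')) (stdGaussianPi κ) :=
  measurePreserving_fst.comp
    (measurePreserving_sumPiEquivProdPi (X := fun _ : κ ⊕ κ' => ℝ) fun _ => gaussianReal 0 1)

theorem measurePreserving_comp_inr_stdGaussianPi :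
    MeasurePreserving (fun x : κ ⊕ κ' → ℝ => x ∘ Sum.inr)
      (stdGaussianPi (κ ⊕ κ')) (stdGaussianPi κ') :=
  measurePreserving_snd.comp
    (measurePreserving_sumPiEquivProdPi (X := fun _ : κ ⊕ κ' => ℝ) fun _ => gaussianReal 0 1)

variable [Fintype ι] [Nonempty ι]

/-- The Sudakov-Fernique inequality for `logSumExp`. -/
theorem integral_logSumExp_le (A : Matrix ι κ ℝ) (B : Matrix ι κ' ℝ)
    (hinc : ∀ i j, ∑ k, (A i k - A j k) ^ 2 ≤ ∑ k, (B i k - B j k) ^ 2) :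
    ∫ x, logSumExp (A *ᵥ x) ∂stdGaussianPi κ ≤ ∫ x, logSumExp (B *ᵥ x) ∂stdGaussianPi κ' := by
  have h := integral_logSumExp_le_of_orthogonal (Matrix.fromCols A (0 : Matrix ι κ' ℝ))
    (Matrix.fromCols (0 : Matrix ι κ ℝ) B)
    (by ext i j; simp [Matrix.mul_apply, Fintype.sum_sum_type])
    (fun i j => by simpa [Fintype.sum_sum_type] using hinc i j)
  have hA := measurePreserving_comp_inl_stdGaussianPi (κ := κ) (κ' := κ')
  have hB := measurePreserving_comp_inr_stdGaussianPi (κ := κ) (κ' := κ')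
  have cA : Continuous fun x => logSumExp (A *ᵥ x) :=
    continuous_logSumExp.comp (continuous_mulVec_apply A)
  have cB : Continuous fun x => logSumExp (B *ᵥ x) :=
    continuous_logSumExp.comp (continuous_mulVec_apply B)
  rw [← hA.map_eq, ← hB.map_eq, integral_map hA.aemeasurable cA.aestronglyMeasurable,
    integral_map hB.aemeasurable cB.aestronglyMeasurable]
  simpa [Matrix.fromCols_mulVec] using h

theorem abs_ciSup_le_sum (y : ι → ℝ) : |⨆ i, y i| ≤ ∑ i, |y i| := by
  have hs (i : ι) : |y i| ≤ ∑ i, |y i| :=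
    Finset.single_le_sum (f := fun i => |y i|) (fun _ _ => abs_nonneg _) (Finset.mem_univ i)
  refine abs_le.2 ⟨?_, ciSup_le fun i => (le_abs_self _).trans (hs i)⟩
  obtain ⟨i⟩ := ‹Nonempty ι›
  have := le_ciSup (Set.finite_range y).bddAbove i
  linarith [hs i, neg_abs_le (y i)]

theorem integrable_ciSup_mulVec (A : Matrix ι κ ℝ) :
    Integrable (fun x => ⨆ i, (A *ᵥ x) i) (stdGaussianPi κ) := by
  refine Integrable.mono' (g := fun x => ∑ i, |(A *ᵥ x) i|)
    (integrable_finsetSum _ fun i _ => (integrable_mulVec_stdGaussianPi A i).abs) ?_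
    (ae_of_all _ fun x => abs_ciSup_le_sum _)
  exact (Measurable.iSup fun i =>
    ((continuous_apply i).comp (continuous_mulVec_apply A)).measurable).aestronglyMeasurable

theorem mul_ciSup_le_logSumExp {β : ℝ} (hβ : 0 ≤ β) (y : ι → ℝ) :
    β * (⨆ i, y i) ≤ logSumExp (β • y) := by
  rw [Real.mul_iSup_of_nonneg hβ]
  exact ciSup_le fun i => le_logSumExp (β • y) i

/-- The **Sudakov-Fernique inequality**: larger increments give a larger expected maximum. -/
theorem integral_ciSup_mulVec_le (A : Matrix ι κ ℝ) (B : Matrix ι κ' ℝ)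
    (hinc : ∀ i j, ∑ k, (A i k - A j k) ^ 2 ≤ ∑ k, (B i k - B j k) ^ 2) :
    ∫ x, (⨆ i, (A *ᵥ x) i) ∂stdGaussianPi κ ≤ ∫ x, (⨆ i, (B *ᵥ x) i) ∂stdGaussianPi κ' := by
  have hβ (β : ℝ) (hβ : 0 < β) : β * ∫ x, (⨆ i, (A *ᵥ x) i) ∂stdGaussianPi κ ≤
      β * (∫ x, (⨆ i, (B *ᵥ x) i) ∂stdGaussianPi κ') + Real.log (Fintype.card ι) := by
    have hinc' (i j : ι) :
        ∑ k, ((β • A) i k - (β • A) j k) ^ 2 ≤ ∑ k, ((β • B) i k - (β • B) j k) ^ 2 := by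
      simp only [Matrix.smul_apply, smul_eq_mul, ← mul_sub, mul_pow, ← Finset.mul_sum]
      exact mul_le_mul_of_nonneg_left (hinc i j) (sq_nonneg β)
    calc β * ∫ x, (⨆ i, (A *ᵥ x) i) ∂stdGaussianPi κ
        ≤ ∫ x, logSumExp ((β • A) *ᵥ x) ∂stdGaussianPi κ := by
          rw [← integral_const_mul]
          refine integral_mono ((integrable_ciSup_mulVec A).const_mul β)
            (integrable_logSumExp_mulVec _) fun x => ?_
          simp only [Matrix.smul_mulVec]
          exact mul_ciSup_le_logSumExp hβ.le _
      _ ≤ ∫ x, logSumExp ((β • B) *ᵥ x) ∂stdGaussianPi κ' := integral_logSumExp_le _ _ hinc'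
      _ ≤ ∫ x, (β * (⨆ i, (B *ᵥ x) i) + Real.log (Fintype.card ι)) ∂stdGaussianPi κ' := by
          refine integral_mono (integrable_logSumExp_mulVec _)
            (((integrable_ciSup_mulVec B).const_mul β).add (integrable_const _)) fun x => ?_
          refine logSumExp_le fun i => ?_
          simp only [Matrix.smul_mulVec, Pi.smul_apply, smul_eq_mul]
          exact mul_le_mul_of_nonneg_left (le_ciSup (Set.finite_range (B *ᵥ x)).bddAbove i) hβ.le
      _ = _ := by
          rw [integral_add ((integrable_ciSup_mulVec B).const_mul β) (integrable_const _),
            integral_const_mul]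
          simp
  refine le_of_forall_pos_le_add fun ε hε => ?_
  have hL : 0 ≤ Real.log (Fintype.card ι) := Real.log_natCast_nonneg _
  have hβ0 : 0 < (Real.log (Fintype.card ι) + 1) / ε := by positivity
  have h := hβ _ hβ0
  refine le_of_mul_le_mul_left (h.trans ?_) hβ0
  rw [mul_add, div_mul_cancel₀ _ hε.ne']
  linarith

/-- The expected maximum of `N` independent standard Gaussians is at most `√(2 log N)`. -/
theorem integral_ciSup_stdGaussianPi_le (hι : 2 ≤ Fintype.card ι) :
    ∫ x, (⨆ i, x i) ∂stdGaussianPi ι ≤ √(2 * Real.log (Fintype.card ι)) := by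
  classical
  set N : ℝ := ((Fintype.card ι : ℕ) : ℝ) with hN
  have hN2 : (2 : ℝ) ≤ N := by rw [hN]; exact_mod_cast hι
  have hlog : 0 < Real.log N := Real.log_pos (by linarith)
  set β := √(2 * Real.log N) with hβ
  have hβ0 : 0 < β := Real.sqrt_pos.2 (by linarith)
  have hβ2 : β ^ 2 = 2 * Real.log N := Real.sq_sqrt (by linarith)
  set c := N * Real.exp (β ^ 2 / 2) with hc
  have hc0 : 0 < c := by positivity
  have hsup : Integrable (fun x : ι → ℝ => ⨆ i, x i) (stdGaussianPi ι) := by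
    simpa using integrable_ciSup_mulVec (1 : Matrix ι ι ℝ)
  have hexp (i : ι) : Integrable (fun x : ι → ℝ => Real.exp (β * x i)) (stdGaussianPi ι) :=
    (measurePreserving_eval (fun _ : ι => gaussianReal 0 1) i).integrable_comp_of_integrable
      (g := fun t => Real.exp (β * t)) (integrable_exp_mul_gaussianReal β)
  have hS : Integrable (fun x : ι → ℝ => (∑ i, Real.exp (β * x i)) / c) (stdGaussianPi ι) :=
    (integrable_finsetSum _ fun i _ => hexp i).div_const c
  have hS' : Integrable (fun x : ι → ℝ => (∑ i, Real.exp (β * x i)) / c - 1) (stdGaussianPi ι) :=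
    hS.sub (integrable_const 1)
  have hmgf (i : ι) : ∫ x, Real.exp (β * x i) ∂stdGaussianPi ι = Real.exp (β ^ 2 / 2) := by
    have h := mgf_gaussianReal (μ := 0) (v := 1)
      (measurePreserving_eval (fun _ : ι => gaussianReal 0 1) i).map_eq β
    simpa [mgf] using h
  have key : β * ∫ x, (⨆ i, x i) ∂stdGaussianPi ι ≤ Real.log c := by
    rw [← integral_const_mul]
    calc _ ≤ ∫ x, ((∑ i, Real.exp (β * x i)) / c - 1 + Real.log c) ∂stdGaussianPi ι := by
          refine integral_mono (hsup.const_mul β)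
            (hS'.add (integrable_const _)) fun x => ?_
          refine (mul_ciSup_le_logSumExp hβ0.le x).trans ?_
          have hp := sum_exp_pos (β • x)
          have := Real.log_le_sub_one_of_pos (div_pos hp hc0)
          rw [Real.log_div hp.ne' hc0.ne'] at this
          simp only [logSumExp, Pi.smul_apply, smul_eq_mul] at this ⊢
          linarith
      _ = Real.log c := by
          rw [integral_add hS' (integrable_const _),
            integral_sub hS (integrable_const _), integral_div, integral_finsetSum _ fun i _ => hexp i]
          simp only [hmgf]
          simp only [integral_const, probReal_univ, smul_eq_mul, Finset.sum_const,
            Finset.card_univ, nsmul_eq_mul]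
          rw [← hN, ← hc, div_self hc0.ne']
          ring
  have hlogc : Real.log c = β * β := by
    rw [hc, Real.log_mul (by linarith) (Real.exp_pos _).ne', Real.log_exp]
    linarith
  rw [hlogc] at key
  exact le_of_mul_le_mul_left key hβ0

end Comparison

section TraceBasis

variable {κ n : Type*} [Fintype κ] [Fintype n] [DecidableEq κ] [DecidableEq n]

/-- Parseval's identity for a basis of matrices orthonormal with respect to the trace form. -/
theorem sum_trace_mul_trace_mul (F : κ → Matrix n n ℂ)
    (hcard : Fintype.card κ = Fintype.card (n × n))
    (hF : ∀ k l, (F k * F l).trace = if k = l then (1 : ℂ) else 0) (X Y : Matrix n n ℂ) :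
    ∑ k, (F k * X).trace * (F k * Y).trace = (X * Y).trace := by
  set U : Matrix κ (n × n) ℂ := Matrix.of fun k p => F k p.1 p.2 with hU
  set W : Matrix (n × n) κ ℂ := Matrix.of fun p k => F k p.2 p.1 with hW
  have hUW : U * W = 1 := by
    ext k l
    rw [Matrix.one_apply, ← hF k l]
    simp [hU, hW, Matrix.mul_apply, Matrix.trace, Fintype.sum_prod_type]
  have hWU : W * U = 1 := (Matrix.mul_eq_one_comm_of_card_eq _ _ _ hcard).1 hUW
  set x : n × n → ℂ := fun p => X p.1 p.2
  set y : n × n → ℂ := fun p => Y p.2 p.1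
  have hx (k : κ) : (x ᵥ* W) k = (F k * X).trace := by
    rw [Matrix.trace_mul_comm]
    simp [x, hW, Matrix.mul_apply, Matrix.trace, Fintype.sum_prod_type, Matrix.vecMul, dotProduct]
  have hy (k : κ) : (U *ᵥ y) k = (F k * Y).trace := by
    simp [y, hU, Matrix.mul_apply, Matrix.trace, Fintype.sum_prod_type, Matrix.mulVec, dotProduct]
  calc ∑ k, (F k * X).trace * (F k * Y).trace = (x ᵥ* W) ⬝ᵥ (U *ᵥ y) := by
        simp only [dotProduct, hx, hy]
    _ = x ⬝ᵥ y := by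
        rw [← Matrix.dotProduct_mulVec, Matrix.mulVec_mulVec, hWU, Matrix.one_mulVec]
    _ = (X * Y).trace := by
        simp [x, y, Matrix.mul_apply, Matrix.trace, Fintype.sum_prod_type, dotProduct]

end TraceBasis

section Hamiltonian

variable {d : ℕ}

/-- Parseval's identity for an orthonormal basis of the traceless matrices. -/
theorem sum_trace_mul_trace_mul_of_traceless (hd : 1 ≤ d)
    {E : Fin (d ^ 2 - 1) → Matrix (Fin d) (Fin d) ℂ} (htr : ∀ k, (E k).trace = 0)
    (horth : ∀ k l, (E k * E l).trace = if k = l then (1 : ℂ) else 0)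
    {X Y : Matrix (Fin d) (Fin d) ℂ} (hX : X.trace = 0) :
    ∑ k, (E k * X).trace * (E k * Y).trace = (X * Y).trace := by
  set c : ℂ := ((√(d : ℝ) : ℝ) : ℂ)⁻¹ with hc
  have hd0 : (d : ℂ) ≠ 0 := by exact_mod_cast (by omega : d ≠ 0)
  have hcc : c * c * d = 1 := by
    have h : ((√(d : ℝ) : ℝ) : ℂ) * ((√(d : ℝ) : ℝ) : ℂ) = d := by
      rw [← Complex.ofReal_mul, Real.mul_self_sqrt (Nat.cast_nonneg d)]
      simp
    rw [hc, ← mul_inv, h, inv_mul_cancel₀ hd0]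
  have hcard : Fintype.card (Option (Fin (d ^ 2 - 1))) = Fintype.card (Fin d × Fin d) := by
    have : 1 ≤ d ^ 2 := Nat.one_le_pow _ _ hd
    simp only [Fintype.card_option, Fintype.card_fin, Fintype.card_prod, ← pow_two]
    omega
  have h := sum_trace_mul_trace_mul
    (fun o : Option (Fin (d ^ 2 - 1)) => o.elim (c • (1 : Matrix (Fin d) (Fin d) ℂ)) E) hcard
    (fun k l => by
      rcases k with _ | k <;> rcases l with _ | l <;>
        simp [htr, horth, ← mul_assoc, hcc]) X Y
  simpa [Fintype.sum_option, hX] using h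

theorem trace_Qmat_sub {ψ φ : Fin d → ℂ} (hψ : star ψ ⬝ᵥ ψ = 1) (hφ : star φ ⬝ᵥ φ = 1) :
    (Qmat ψ - Qmat φ).trace = 0 := by
  simp [Qmat, Matrix.trace_vecMulVec, dotProduct_comm _ (star _), hψ, hφ]

theorem trace_Qmat_sub_mul_self {ψ φ : Fin d → ℂ} (hψ : star ψ ⬝ᵥ ψ = 1)
    (hφ : star φ ⬝ᵥ φ = 1) :
    ((Qmat ψ - Qmat φ) * (Qmat ψ - Qmat φ)).trace =
      ((2 * (1 - Complex.normSq (star ψ ⬝ᵥ φ)) : ℝ) : ℂ) := by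
  have hQ : Qmat ψ - Qmat φ = vecMulVec ψ (star ψ) - vecMulVec φ (star φ) := by
    simp [Qmat]
  have hconj : star φ ⬝ᵥ ψ = (starRingEnd ℂ) (star ψ ⬝ᵥ φ) := by
    rw [starRingEnd_apply, Matrix.star_dotProduct]
  have hn : (star ψ ⬝ᵥ φ) * (star φ ⬝ᵥ ψ) = (Complex.normSq (star ψ ⬝ᵥ φ) : ℂ) := by
    rw [hconj, Complex.mul_conj]
  rw [hQ]
  simp only [Matrix.sub_mul, Matrix.mul_sub, Matrix.vecMulVec_mul_vecMulVec, Matrix.trace_sub,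
    Matrix.trace_vecMulVec, hψ, hφ, dotProduct_smul, smul_eq_mul, one_smul,
    dotProduct_comm _ (star _)]
  push_cast
  rw [mul_comm (star φ ⬝ᵥ ψ), hn]
  ring

theorem isHermitian_Qmat (ψ : Fin d → ℂ) : (Qmat ψ).IsHermitian := by
  have h : (vecMulVec ψ (star ψ)).IsHermitian := by
    ext i j
    simp [Matrix.vecMulVec_apply, mul_comm]
  refine h.sub ?_
  ext i j
  by_cases hij : i = j <;> simp [hij, eq_comm]

theorem ofReal_re_trace_mul {A B : Matrix (Fin d) (Fin d) ℂ} (hA : A.IsHermitian)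
    (hB : B.IsHermitian) : (((A * B).trace.re : ℝ) : ℂ) = (A * B).trace := by
  rw [← Complex.conj_eq_iff_re, starRingEnd_apply, ← Matrix.trace_conjTranspose,
    Matrix.conjTranspose_mul, hA.eq, hB.eq, Matrix.trace_mul_comm]

/-- The coefficient matrix of the Gaussian process `ψ ↦ Tr (H Q_ψ)` over a list of vectors. -/
def hamiltonianCoeff {ι : Type*} (E : Fin (d ^ 2 - 1) → Matrix (Fin d) (Fin d) ℂ)
    (S : ι → Fin d → ℂ) : Matrix ι (Fin (d ^ 2 - 1)) ℝ :=
  Matrix.of fun i k => ((E k * Qmat (S i)).trace).re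

theorem sum_sq_hamiltonianCoeff_sub {ι : Type*} (hd : 1 ≤ d)
    {E : Fin (d ^ 2 - 1) → Matrix (Fin d) (Fin d) ℂ} (hE : ∀ k, (E k).IsHermitian)
    (htr : ∀ k, (E k).trace = 0)
    (horth : ∀ k l, (E k * E l).trace = if k = l then (1 : ℂ) else 0)
    {S : ι → Fin d → ℂ} (hS : ∀ i, star (S i) ⬝ᵥ S i = 1) (i j : ι) :
    ∑ k, (hamiltonianCoeff E S i k - hamiltonianCoeff E S j k) ^ 2 =
      2 * (1 - Complex.normSq (star (S i) ⬝ᵥ S j)) := by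
  have h := sum_trace_mul_trace_mul_of_traceless hd htr horth (Y := Qmat (S i) - Qmat (S j))
    (trace_Qmat_sub (hS i) (hS j))
  rw [trace_Qmat_sub_mul_self (hS i) (hS j)] at h
  have hre (k) : (E k * (Qmat (S i) - Qmat (S j))).trace =
      ((hamiltonianCoeff E S i k - hamiltonianCoeff E S j k : ℝ) : ℂ) := by
    rw [← ofReal_re_trace_mul (hE k) ((isHermitian_Qmat _).sub (isHermitian_Qmat _))]
    simp [hamiltonianCoeff, Matrix.mul_sub]
  simp only [hre, ← pow_two] at h
  exact_mod_cast h

theorem integral_ciSup_hamiltonian {ι Ω : Type*} [Fintype ι] [Nonempty ι] [MeasurableSpace Ω]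
    {μ : Measure Ω} {H : Ω → Matrix (Fin d) (Fin d) ℂ}
    {E : Fin (d ^ 2 - 1) → Matrix (Fin d) (Fin d) ℂ} {g : Fin (d ^ 2 - 1) → Ω → ℝ}
    (hg : Measurable fun ω k => g k ω)
    (hlaw : Measure.map (fun ω k => g k ω) μ = stdGaussianPi (Fin (d ^ 2 - 1)))
    (hH : ∀ ω, H ω = ∑ k, (g k ω : ℂ) • E k) (S : ι → Fin d → ℂ) :
    ∫ ω, (⨆ i, ((H ω * Qmat (S i)).trace).re) ∂μ =
      ∫ x, (⨆ i, (hamiltonianCoeff E S *ᵥ x) i) ∂stdGaussianPi (Fin (d ^ 2 - 1)) := by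
  have hint := integrable_ciSup_mulVec (hamiltonianCoeff E S)
  rw [← hlaw] at hint ⊢
  rw [integral_map hg.aemeasurable hint.aestronglyMeasurable]
  congr with ω
  congr with i
  simp [hH, hamiltonianCoeff, Matrix.sum_mul, Matrix.mulVec, dotProduct, Matrix.trace_sum, mul_comm]

end Hamiltonian

section Width

variable {d : ℕ}

theorem sum_sq_one_sub {ι : Type*} [Fintype ι] [DecidableEq ι] {i j : ι} (h : i ≠ j) :
    ∑ k, ((1 : Matrix ι ι ℝ) i k - (1 : Matrix ι ι ℝ) j k) ^ 2 = 2 := by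
  have (k : ι) : ((1 : Matrix ι ι ℝ) i k - (1 : Matrix ι ι ℝ) j k) ^ 2 =
      (1 : Matrix ι ι ℝ) i k + (1 : Matrix ι ι ℝ) j k := by
    by_cases h1 : i = k
    · subst h1
      simp [h.symm]
    · by_cases h2 : j = k <;> simp [Matrix.one_apply, h1, h2]
  simp only [this, Finset.sum_add_distrib]
  simp [Matrix.one_apply]
  norm_num

/-- Every list of unit vectors has width at most the expected maximum of independent standard
Gaussians. -/
theorem integral_ciSup_hamiltonianCoeff_le {ι : Type*} [Fintype ι] [Nonempty ι] (hd : 1 ≤ d)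
    {E : Fin (d ^ 2 - 1) → Matrix (Fin d) (Fin d) ℂ} (hE : ∀ k, (E k).IsHermitian)
    (htr : ∀ k, (E k).trace = 0)
    (horth : ∀ k l, (E k * E l).trace = if k = l then (1 : ℂ) else 0)
    {S : ι → Fin d → ℂ} (hS : ∀ i, star (S i) ⬝ᵥ S i = 1) :
    ∫ x, (⨆ i, (hamiltonianCoeff E S *ᵥ x) i) ∂stdGaussianPi (Fin (d ^ 2 - 1)) ≤
      ∫ x, (⨆ i, x i) ∂stdGaussianPi ι := by
  classical
  have h := integral_ciSup_mulVec_le (hamiltonianCoeff E S) (1 : Matrix ι ι ℝ) fun i j => by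
    by_cases hij : i = j
    · simpa [hij] using Finset.sum_nonneg fun k _ => sq_nonneg _
    · rw [sum_sq_one_sub hij, sum_sq_hamiltonianCoeff_sub hd hE htr horth hS]
      linarith [Complex.normSq_nonneg (star (S i) ⬝ᵥ S j)]
  simpa using h

/-- The width of a complete MUB ensemble is at least `√(1 - 1 / d)` times the expected maximum
of independent standard Gaussians. -/
theorem le_integral_ciSup_hamiltonianCoeff_of_isCompleteMUB (hd : 1 ≤ d)
    {E : Fin (d ^ 2 - 1) → Matrix (Fin d) (Fin d) ℂ} (hE : ∀ k, (E k).IsHermitian)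
    (htr : ∀ k, (E k).trace = 0)
    (horth : ∀ k l, (E k * E l).trace = if k = l then (1 : ℂ) else 0)
    {B : Fin (d + 1) → Fin d → Fin d → ℂ} (hB : IsCompleteMUB B) :
    √(1 - 1 / (d : ℝ)) * ∫ x, (⨆ p, x p) ∂stdGaussianPi (Fin (d + 1) × Fin d) ≤
      ∫ x, (⨆ p, (hamiltonianCoeff E (fun p : Fin (d + 1) × Fin d => B p.1 p.2) *ᵥ x) p)
        ∂stdGaussianPi (Fin (d ^ 2 - 1)) := by
  have : NeZero d := ⟨by omega⟩
  have hd1 : (1 : ℝ) ≤ d := by exact_mod_cast hd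
  have hs : 0 ≤ 1 - 1 / (d : ℝ) := by
    rw [sub_nonneg, div_le_one (by linarith)]
    exact hd1
  have hS (p : Fin (d + 1) × Fin d) : star (B p.1 p.2) ⬝ᵥ B p.1 p.2 = 1 := by
    simpa using hB.1 p.1 p.2 p.2
  have h := integral_ciSup_mulVec_le
    (√(1 - 1 / (d : ℝ)) • (1 : Matrix (Fin (d + 1) × Fin d) (Fin (d + 1) × Fin d) ℝ))
    (hamiltonianCoeff E (fun p : Fin (d + 1) × Fin d => B p.1 p.2)) fun p q => by
      by_cases hpq : p = q
      · simp [hpq]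
      simp only [Matrix.smul_apply, smul_eq_mul, ← mul_sub, mul_pow, ← Finset.mul_sum,
        sum_sq_one_sub hpq, Real.sq_sqrt hs, sum_sq_hamiltonianCoeff_sub hd hE htr horth hS]
      by_cases hab : p.1 = q.1
      · have hne : p.2 ≠ q.2 := fun hne => hpq (Prod.ext hab hne)
        have h0 : star (B p.1 p.2) ⬝ᵥ B q.1 q.2 = 0 := by
          rw [← hab, hB.1, if_neg hne]
        have : 0 ≤ 1 / (d : ℝ) := by positivity
        rw [h0, map_zero]
        linarith
      · rw [hB.2 _ _ _ _ hab]
        linarith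
  simpa [Matrix.smul_mulVec, ← Real.mul_iSup_of_nonneg (Real.sqrt_nonneg _),
    integral_const_mul] using h

/-- The finite-dimensional form of additive optimality, with an explicit error term. -/
theorem width_le_width_add (hd : 1 ≤ d) {Ω : Type*} [MeasurableSpace Ω] {μ : Measure Ω}
    {H : Ω → Matrix (Fin d) (Fin d) ℂ} (hH : IsStdGaussianHamiltonian μ H)
    {B : Fin (d + 1) → Fin d → Fin d → ℂ} (hB : IsCompleteMUB B)
    {S : Fin (d * (d + 1)) → Fin d → ℂ} (hS : ∀ i, star (S i) ⬝ᵥ S i = (1 : ℂ)) :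
    ∫ ω, (⨆ i, ((H ω * Qmat (S i)).trace).re) ∂μ ≤
      ∫ ω, (⨆ p : Fin (d + 1) × Fin d, ((H ω * Qmat (B p.1 p.2)).trace).re) ∂μ +
        (1 - √(1 - 1 / (d : ℝ))) * √(2 * Real.log (d * (d + 1))) := by
  have : NeZero d := ⟨by omega⟩
  obtain ⟨E, g, hE, htr, horth, hg, hlaw, hHE⟩ := hH
  let e : Fin (d + 1) × Fin d ≃ Fin (d * (d + 1)) :=
    Fintype.equivOfCardEq (by simp [mul_comm])
  have hre (ω : Ω) : ⨆ i, ((H ω * Qmat (S i)).trace).re =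
      ⨆ p, ((H ω * Qmat (S (e p))).trace).re :=
    (e.iSup_comp (g := fun i => ((H ω * Qmat (S i)).trace).re)).symm
  simp only [hre]
  rw [integral_ciSup_hamiltonian hg hlaw hHE (fun p => S (e p)),
    integral_ciSup_hamiltonian hg hlaw hHE (fun p : Fin (d + 1) × Fin d => B p.1 p.2)]
  have h1 := integral_ciSup_hamiltonianCoeff_le hd hE htr horth (fun p => hS (e p))
  have h2 := le_integral_ciSup_hamiltonianCoeff_of_isCompleteMUB hd hE htr horth hB
  have h3 := integral_ciSup_stdGaussianPi_le (ι := Fin (d + 1) × Fin d) (by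
    simp only [Fintype.card_prod, Fintype.card_fin]
    nlinarith)
  have h4 : 0 ≤ 1 - √(1 - 1 / (d : ℝ)) := by
    have : 0 ≤ 1 / (d : ℝ) := by positivity
    rw [sub_nonneg, Real.sqrt_le_one]
    linarith
  have hcard : ((Fintype.card (Fin (d + 1) × Fin d) : ℕ) : ℝ) = d * (d + 1) := by
    simp [mul_comm]
  rw [hcard] at h3
  have := mul_le_mul_of_nonneg_left h3 h4
  linarith

end Width

section Asymptotics

/-- The relative error in the optimality bound, as a function of the dimension. -/
def relativeError (x : ℝ) : ℝ :=
  √(2 * Real.log (x * (x + 1))) / ((1 + √(1 - 1 / x)) * √(Real.log x)) - 1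

theorem tendsto_relativeError : Filter.Tendsto relativeError Filter.atTop (nhds 0) := by
  have hinv : Filter.Tendsto (fun x : ℝ => 1 / x) Filter.atTop (nhds 0) := by
    simpa using tendsto_inv_atTop_zero (𝕜 := ℝ)
  have hlog : Filter.Tendsto (fun x : ℝ => Real.log (1 + 1 / x) / Real.log x)
      Filter.atTop (nhds 0) := by
    refine Filter.Tendsto.div_atTop (a := Real.log (1 + 0)) ?_ Real.tendsto_log_atTop
    exact (hinv.const_add 1).log (by norm_num)
  have hmain : Filter.Tendsto (fun x : ℝ =>
      √(2 * (2 + Real.log (1 + 1 / x) / Real.log x)) / (1 + √(1 - 1 / x)) - 1)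
      Filter.atTop (nhds (√(2 * (2 + 0)) / (1 + √(1 - 0)) - 1)) := by
    refine Filter.Tendsto.sub_const (Filter.Tendsto.div ?_ ?_ ?_) 1
    · exact ((hlog.const_add 2).const_mul 2).sqrt
    · exact ((hinv.const_sub 1).sqrt).const_add 1
    · positivity
  have hlim : √(2 * (2 + 0)) / (1 + √(1 - 0)) - 1 = 0 := by
    have : √(2 * (2 + 0) : ℝ) = 2 := by
      rw [Real.sqrt_eq_iff_mul_self_eq_of_pos] <;> norm_num
    rw [this]
    norm_num
  rw [hlim] at hmain
  refine hmain.congr' ?_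
  filter_upwards [Filter.eventually_gt_atTop 1] with x hx
  have hx0 : 0 < x := by linarith
  have hl : 0 < Real.log x := Real.log_pos hx
  have hprod : Real.log (x * (x + 1)) = Real.log x * (2 + Real.log (1 + 1 / x) / Real.log x) := by
    have : x * (x + 1) = x * (x * (1 + 1 / x)) := by field_simp
    rw [this, Real.log_mul hx0.ne' (by positivity), Real.log_mul hx0.ne' (by positivity)]
    field_simp
    ring
  have hs : 0 < √(Real.log x) := Real.sqrt_pos.2 hl
  rw [relativeError, hprod, mul_left_comm, Real.sqrt_mul hl.le]
  field_simp

theorem one_sub_sqrt_mul_eq {x : ℝ} (hx : 1 < x) :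
    (1 - √(1 - 1 / x)) * √(2 * Real.log (x * (x + 1))) =
      √(Real.log x) / x * (1 + relativeError x) := by
  have hx0 : 0 < x := by linarith
  have hs : 0 < √(Real.log x) := Real.sqrt_pos.2 (Real.log_pos hx)
  have hσ : 0 ≤ 1 - 1 / x := by
    rw [sub_nonneg, div_le_one hx0]
    exact hx.le
  have h1 : 0 < 1 + √(1 - 1 / x) := by positivity
  have h2 : 1 - √(1 - 1 / x) = 1 / x / (1 + √(1 - 1 / x)) := by
    rw [eq_div_iff h1.ne']
    nlinarith [Real.sq_sqrt hσ]
  rw [h2, relativeError]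
  field_simp
  ring

end Asymptotics

/-- **asymptotic additive optimality among arbitrary ensembles.**
There is `ε : ℕ → ℝ` with `ε n → 0` such that for every `n`, with `d = 2^n` and
`N = d(d+1)`, every `N`-point list `S` of unit vectors in `ℂ^d` satisfies
`W(S) ≤ W(M) + (√(log d)/d)·(1 + ε n)` for any complete MUB ensemble `M`. -/
theorem mub_asymptotic_additive_optimality :
    ∃ ε : ℕ → ℝ, Filter.Tendsto ε Filter.atTop (nhds 0) ∧
      ∀ (n : ℕ) {Ω : Type} [MeasurableSpace Ω] (μ : Measure Ω)
        [IsProbabilityMeasure μ]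
        (H : Ω → Matrix (Fin (2 ^ n)) (Fin (2 ^ n)) ℂ),
        IsStdGaussianHamiltonian μ H →
        ∀ (B : Fin (2 ^ n + 1) → Fin (2 ^ n) → Fin (2 ^ n) → ℂ),
          IsCompleteMUB B →
        ∀ (S : Fin (2 ^ n * (2 ^ n + 1)) → Fin (2 ^ n) → ℂ),
          (∀ i, star (S i) ⬝ᵥ S i = (1 : ℂ)) →
          (∫ ω, (⨆ i, ((H ω * Qmat (S i)).trace).re) ∂μ) ≤
            (∫ ω, (⨆ p : Fin (2 ^ n + 1) × Fin (2 ^ n),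
                ((H ω * Qmat (B p.1 p.2)).trace).re) ∂μ) +
              Real.sqrt (Real.log (2 ^ n)) / 2 ^ n * (1 + ε n) := by
  refine ⟨fun n => relativeError (2 ^ n),
    tendsto_relativeError.comp (tendsto_pow_atTop_atTop_of_one_lt one_lt_two), ?_⟩
  intro n Ω _ μ _ H hH B hB S hS
  rcases Nat.eq_zero_or_pos n with rfl | hn
  · obtain ⟨E, g, -, -, -, -, -, hHE⟩ := hH
    have : IsEmpty (Fin ((2 ^ 0) ^ 2 - 1)) := by
      norm_num
      infer_instance
    have h0 (ω : Ω) : H ω = 0 := by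
      rw [hHE, Fintype.sum_empty]
    simp [h0]
  · have h := width_le_width_add Nat.one_le_two_pow hH hB hS
    have h1 : (1 : ℝ) < 2 ^ n := one_lt_pow₀ one_lt_two hn.ne'
    rw [← one_sub_sqrt_mul_eq h1]
    simpa using h
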